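/- arXiv:1504.04966 — 4 statements merged into one kernel-verified Lean document; each statement's English description precedes it below -/
import Mathlib

section
/- Fiber product cover structure: let β > 1 have generating sequence g(β) that is eventually periodic but not periodic, with n ≥ 1 and p ≥ 1 minimal such that g(β) = g_1 ⋯ g_n (g_{n+1} ⋯ g_{n+p})^∞. In the fiber product graph of the Fischer graph F_β, the set of off-diagonal vertices (u, v) with u ≠ v that lie on some bi-infinite path of the fiber product graph has exactly 2p elements. -/
/-- The remainders `r_n(t)` of the β-expansion of `t` (0-indexed: `betaRem β t n = r_n(t)`). -/
noncomputable def betaRem (β t : ℝ) : ℕ → ℝ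
  | 0 => t
  | n + 1 => Int.fract (β * betaRem β t n)

/-- `betaDigit β t n` is the digit `x_{n+1}(t)` of the β-expansion of `t` (0-indexed). -/
noncomputable def betaDigit (β t : ℝ) (n : ℕ) : ℕ :=
  (⌊β * betaRem β t n⌋).toNat

/- The generating sequence `g(β)`, 0-indexed: `genSeq β i = g_{i+1}`.
If `e(β)` is eventually zero with last nonzero digit at (0-indexed) position `k`,
then `g(β)` is the periodic sequence of period `k+1` obtained from the initial word
of `e(β)` of length `k+1` by decreasing its last letter by one; otherwise `g(β) = e(β)`. -/
open scoped Classical in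
noncomputable def genSeq (β : ℝ) : ℕ → ℕ :=
  if h : ∃ k, betaDigit β 1 k ≠ 0 ∧ ∀ m, k < m → betaDigit β 1 m = 0 then
    fun i =>
      if i % (Nat.find h + 1) = Nat.find h then betaDigit β 1 (Nat.find h) - 1
      else betaDigit β 1 (i % (Nat.find h + 1))
  else
    betaDigit β 1

/-- Strict lexicographic order on one-sided sequences. -/
def lexLt (x y : ℕ → ℕ) : Prop :=
  ∃ n, (∀ i < n, x i = y i) ∧ x n < y n

/-- Lexicographic order on one-sided sequences. -/
def lexLe (x y : ℕ → ℕ) : Prop :=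
  x = y ∨ lexLt x y

/-- Membership in the beta-shift `X_β` (bi-infinite sequences). -/
def memBeta (β : ℝ) (x : ℤ → ℕ) : Prop :=
  ∀ k : ℤ, lexLe (fun n : ℕ => x (k + n)) (genSeq β)

/-- Membership in the right-ray space `X_β⁺`. -/
def rightRay (β : ℝ) (x : ℕ → ℕ) : Prop :=
  ∀ k : ℕ, lexLe (fun n : ℕ => x (k + n)) (genSeq β)

/-- The edge relation of the Fischer graph `F_β` of a sofic beta-shift whose generating
sequence is `g = g_1 g_2 ⋯` (0-indexed: `g i = g_{i+1}`) with minimal decomposition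
`g(β) = g_1 ⋯ g_n (g_{n+1} ⋯ g_{n+p})^∞`.  `fischerEdge g n p a i j` says that there is
an edge labeled `a` from vertex `i` to vertex `j` (vertices are `1, …, n+p`). -/
def fischerEdge (g : ℕ → ℕ) (n p : ℕ) (a i j : ℕ) : Prop :=
  1 ≤ i ∧ i ≤ n + p ∧
    ((a < g (i - 1) ∧ j = 1) ∨
     (a = g (i - 1) ∧ i < n + p ∧ j = i + 1) ∨
     (a = g (i - 1) ∧ i = n + p ∧ j = n + 1))

/-- Edge relation of the fiber product graph of the Fischer graph. -/
def fpEdge (g : ℕ → ℕ) (n p : ℕ) (a : ℕ) (u v : ℕ × ℕ) : Prop :=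
  fischerEdge g n p a u.1 v.1 ∧ fischerEdge g n p a u.2 v.2

section BetaDigits

lemma betaRem_nonneg {β t : ℝ} (ht : 0 ≤ t) (k : ℕ) : 0 ≤ betaRem β t k := by
  cases k with
  | zero => exact ht
  | succ k => exact Int.fract_nonneg _

lemma betaRem_one_le_one (β : ℝ) (k : ℕ) : betaRem β 1 k ≤ 1 := by
  cases k with
  | zero => exact le_rfl
  | succ k => exact (Int.fract_lt_one _).le

lemma cast_betaDigit {β t : ℝ} (hβ : 0 ≤ β) (ht : 0 ≤ t) (k : ℕ) :
    ((betaDigit β t k : ℕ) : ℤ) = ⌊β * betaRem β t k⌋ :=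
  Int.toNat_of_nonneg (Int.floor_nonneg.2 (mul_nonneg hβ (betaRem_nonneg ht k)))

/-- Every shift of the β-expansion of `1` is lexicographically at most the expansion itself. -/
lemma betaDigit_one_le_of_prefix {β : ℝ} (hβ : 0 ≤ β) (k m : ℕ)
    (h : ∀ i < m, betaDigit β 1 (k + i) = betaDigit β 1 i) :
    betaDigit β 1 (k + m) ≤ betaDigit β 1 m := by
  have key : ∀ j ≤ m, betaRem β 1 (k + j) ≤ betaRem β 1 j := by
    intro j
    induction j with
    | zero => exact fun _ => betaRem_one_le_one β k
    | succ j ih =>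
      intro hj
      have h1 := ih (by omega)
      have h2 : ⌊β * betaRem β 1 (k + j)⌋ = ⌊β * betaRem β 1 j⌋ := by
        rw [← cast_betaDigit hβ zero_le_one, ← cast_betaDigit hβ zero_le_one, h j (by omega)]
      change Int.fract (β * betaRem β 1 (k + j)) ≤ Int.fract (β * betaRem β 1 j)
      rw [Int.fract, Int.fract, h2]
      gcongr
  exact Int.toNat_le_toNat (Int.floor_le_floor (mul_le_mul_of_nonneg_left (key m le_rfl) hβ))

/-- A generating sequence that is not purely periodic is the β-expansion of `1`. -/
lemma genSeq_eq_betaDigit {β : ℝ}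
    (h : ∀ p, 1 ≤ p → ¬ ∀ k, genSeq β (k + p) = genSeq β k) : genSeq β = betaDigit β 1 := by
  classical
  by_cases hz : ∃ k, betaDigit β 1 k ≠ 0 ∧ ∀ m, k < m → betaDigit β 1 m = 0
  · refine absurd (fun k => ?_) (h (Nat.find hz + 1) (by omega))
    simp only [genSeq, dif_pos hz, Nat.add_mod_right]
  · simp only [genSeq, dif_neg hz]

end BetaDigits

section FischerGraph

/-- The successor of a state along the spine of the Fischer graph, states being `0, …, n+p-1`. -/
def spineNext (n p i : ℕ) : ℕ := if i + 1 < n + p then i + 1 else n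

/-- The edges of the Fischer graph on the states `0, …, n+p-1`. -/
def fischerStep (g : ℕ → ℕ) (n p a i j : ℕ) : Prop :=
  i < n + p ∧ ((a < g i ∧ j = 0) ∨ (a = g i ∧ j = spineNext n p i))

variable {g : ℕ → ℕ} {n p : ℕ}

lemma fischerEdge_succ_iff {a i j : ℕ} :
    fischerEdge g n p a (i + 1) (j + 1) ↔ fischerStep g n p a i j := by
  unfold fischerEdge fischerStep spineNext
  rw [Nat.add_sub_cancel]
  split_ifs <;> omega

lemma fischerStep_of_fischerEdge {a u v : ℕ} (h : fischerEdge g n p a u v) :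
    fischerStep g n p a (u - 1) (v - 1) := by
  rw [← fischerEdge_succ_iff]
  have hu : 1 ≤ u := h.1
  have hv : 1 ≤ v := by
    obtain ⟨_, _, h | h | h⟩ := h <;> omega
  rwa [Nat.sub_add_cancel hu, Nat.sub_add_cancel hv]

lemma fischerStep_unique {a i j j' : ℕ} (h : fischerStep g n p a i j)
    (h' : fischerStep g n p a i j') : j = j' := by
  obtain ⟨_, h | h⟩ := h <;> obtain ⟨_, h' | h'⟩ := h' <;> omega

lemma spineNext_ne_zero (hn : 1 ≤ n) (i : ℕ) : spineNext n p i ≠ 0 := by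
  unfold spineNext
  split_ifs <;> omega

/-- Two states `a`, `b` reached by reading a common word, where `b` is reached from the initial
state by reading a word `g_1 ⋯ g_l` that is also read on the spine on the way to `a`. -/
def SpineDominates (g : ℕ → ℕ) (a b : ℕ) : Prop :=
  ∃ k l, (∀ i, g (k + l + i) = g (a + i)) ∧ (∀ i, g (l + i) = g (b + i)) ∧ ∀ i < l, g (k + i) = g i

lemma SpineDominates.zero_right (a : ℕ) : SpineDominates g a 0 :=
  ⟨a, 0, fun _ => rfl, fun _ => rfl, by simp⟩

lemma tail_eq_spineNext (hper : ∀ k, n ≤ k → g (k + p) = g k) {m a : ℕ} (ha : a < n + p)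
    (h : ∀ i, g (m + i) = g (a + i)) (i : ℕ) : g (m + 1 + i) = g (spineNext n p a + i) := by
  have h1 := h (1 + i)
  rw [← add_assoc, ← add_assoc] at h1
  rw [h1, spineNext]
  split_ifs with h2
  · rfl
  · rw [← hper (n + i) (by omega)]
    congr 1
    omega

lemma SpineDominates.step (hn : 1 ≤ n) (hper : ∀ k, n ≤ k → g (k + p) = g k)
    (hlex : ∀ k m, (∀ i < m, g (k + i) = g i) → g (k + m) ≤ g m) {x a b a' b' : ℕ}
    (h : SpineDominates g a b) (ha : fischerStep g n p x a a') (hb : fischerStep g n p x b b') :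
    (a' ≠ 0 ∧ SpineDominates g a' b') ∨ a' = b' := by
  obtain ⟨k, l, hka, hlb, hkl⟩ := h
  obtain ⟨ha0, ⟨ha1, rfl⟩ | ⟨ha1, rfl⟩⟩ := ha <;> obtain ⟨hb0, ⟨hb1, rfl⟩ | ⟨hb1, rfl⟩⟩ := hb
  · exact Or.inr rfl
  · have h1 := hlex k l hkl
    have h2 := hka 0
    have h3 := hlb 0
    simp only [add_zero] at h2 h3
    omega
  · exact Or.inl ⟨spineNext_ne_zero hn a, .zero_right _⟩
  · refine Or.inl ⟨spineNext_ne_zero hn a, k, l + 1, tail_eq_spineNext hper ha0 hka,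
      tail_eq_spineNext hper hb0 hlb, fun i hi => ?_⟩
    rcases Nat.lt_succ_iff_lt_or_eq.1 hi with hi | rfl
    · exact hkl i hi
    · have h2 := hka 0
      have h3 := hlb 0
      simp only [add_zero] at h2 h3
      omega

/-- `A` is a path of the Fischer graph labeled by `x`, on the times up to `0`. -/
def IsPastPath (g : ℕ → ℕ) (n p : ℕ) (x : ℤ → ℕ) (A : ℤ → ℕ) : Prop :=
  ∀ t < 0, fischerStep g n p (x t) (A t) (A (t + 1))

lemma IsPastPath.ne_of_ne_zero {x A B : ℤ → ℕ} (hA : IsPastPath g n p x A)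
    (hB : IsPastPath g n p x B) (h : A 0 ≠ B 0) {t : ℤ} (ht : t ≤ 0) : A t ≠ B t := by
  induction t, ht using Int.leInductionDown with
  | base => exact h
  | pred t ht ih =>
    intro heq
    have h1 := hA (t - 1) (by omega)
    have h2 := hB (t - 1) (by omega)
    rw [heq] at h1
    rw [sub_add_cancel] at h1 h2
    exact ih (fischerStep_unique h1 h2)

/-- Of two paths with the same labels that have not merged, only one can visit the initial state. -/
lemma IsPastPath.not_both_zero (hn : 1 ≤ n) (hper : ∀ k, n ≤ k → g (k + p) = g k)
    (hlex : ∀ k m, (∀ i < m, g (k + i) = g i) → g (k + m) ≤ g m) {x A B : ℤ → ℕ}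
    (hA : IsPastPath g n p x A) (hB : IsPastPath g n p x B) (h : A 0 ≠ B 0) {s t : ℤ}
    (hs : s ≤ 0) (ht : t ≤ 0) (hAs : A s = 0) (hBt : B t = 0) : False := by
  wlog hst : s ≤ t generalizing A B s t
  · exact this hB hA h.symm ht hs hBt hAs (by omega)
  have key : ∀ r, s ≤ r → r ≤ 0 → B r ≠ 0 ∧ SpineDominates g (B r) (A r) := by
    intro r hr
    induction r, hr using Int.leInduction with
    | base =>
      intro _
      have h1 := hA.ne_of_ne_zero hB h hs
      rw [hAs] at h1 ⊢
      exact ⟨h1.symm, .zero_right _⟩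
    | succ r hr ih =>
      intro hr0
      rcases (ih (by omega)).2.step hn hper hlex (hB r (by omega)) (hA r (by omega)) with h1 | h1
      · exact h1
      · exact absurd h1.symm (hA.ne_of_ne_zero hB h hr0)
  exact (key t hst ht).1 hBt

/-- The state at time `t` of the bi-infinite path running through the terminal cycle. -/
def cycleState (n p : ℕ) (t : ℤ) : ℕ := n + (t % p).toNat

lemma cycleState_add_period (t : ℤ) : cycleState n p (t + p) = cycleState n p t := by
  simp [cycleState]

lemma cycleState_natCast {j : ℕ} (hj : j < p) : cycleState n p j = n + j := by
  rw [cycleState, Int.emod_eq_of_lt (by omega) (by omega), Int.toNat_natCast]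

lemma cycleState_lt (hp : 1 ≤ p) (t : ℤ) : cycleState n p t < n + p := by
  have := Int.emod_lt_of_pos t (show (0 : ℤ) < p by omega)
  unfold cycleState
  omega

lemma le_cycleState (t : ℤ) : n ≤ cycleState n p t := Nat.le_add_right _ _

lemma spineNext_cycleState (hp : 1 ≤ p) (t : ℤ) :
    spineNext n p (cycleState n p t) = cycleState n p (t + 1) := by
  have h0 := Int.emod_nonneg t (show (p : ℤ) ≠ 0 by omega)
  have h1 := Int.emod_lt_of_pos t (show (0 : ℤ) < p by omega)
  have h2 : (t + 1) % p = if t % p + 1 < p then t % p + 1 else 0 := by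
    rw [← Int.emod_add_emod]
    split_ifs with h
    · exact Int.emod_eq_of_lt (by omega) h
    · rw [show t % p + 1 = (p : ℤ) by omega, Int.emod_self]
  unfold spineNext cycleState
  rw [h2]
  split_ifs <;> omega

lemma eq_of_spineNext_eq {a b : ℕ} (ha : n ≤ a) (hb : n ≤ b) (ha' : a < n + p) (hb' : b < n + p)
    (h : spineNext n p a = spineNext n p b) : a = b := by
  unfold spineNext at h
  split_ifs at h <;> omega

lemma apply_cycleState_sub (hp : 1 ≤ p) (hper : ∀ k, n ≤ k → g (k + p) = g k) {m : ℕ}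
    (hm : n ≤ m) : g (cycleState n p (m - n)) = g m := by
  induction m using Nat.strong_induction_on with
  | _ m ihm =>
    by_cases hmp : m < n + p
    · have h1 : ((m : ℤ) - n) = ((m - n : ℕ) : ℤ) := by omega
      rw [h1, cycleState_natCast (by omega)]
      congr 1
      omega
    · have h1 := ihm (m - p) (by omega) (by omega)
      rw [← hper (m - p) (by omega), Nat.sub_add_cancel (by omega)] at h1
      rw [← h1, ← cycleState_add_period (((m - p : ℕ) : ℤ) - n)]
      congr 2
      omega

lemma apply_cycleState_add (hp : 1 ≤ p) (hper : ∀ k, n ≤ k → g (k + p) = g k) (t : ℤ) (i : ℕ) :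
    g (cycleState n p (t + i)) = g (cycleState n p t + i) := by
  have h0 := Int.emod_nonneg t (show (p : ℤ) ≠ 0 by omega)
  rw [← apply_cycleState_sub hp hper (le_add_right (le_cycleState t))]
  congr 1
  unfold cycleState
  congr 2
  have h2 : (((n + (t % p).toNat + i : ℕ) : ℤ) - n) = t % p + (i : ℤ) := by
    omega
  rw [h2, Int.emod_add_emod]

lemma fischerStep_cycleState (hp : 1 ≤ p) (t : ℤ) :
    fischerStep g n p (g (cycleState n p t)) (cycleState n p t) (cycleState n p (t + 1)) :=
  ⟨cycleState_lt hp t, Or.inr ⟨rfl, (spineNext_cycleState hp t).symm⟩⟩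

/-- A path never visiting the initial state stays in the terminal cycle. -/
lemma IsPastPath.le_of_ne_zero {x A : ℤ → ℕ} (hA : IsPastPath g n p x A)
    (h : ∀ t ≤ 0, A t ≠ 0) {t : ℤ} (ht : t ≤ 0) : n ≤ A t := by
  suffices H : ∀ i < n, ∀ t ≤ 0, A t ≠ i by
    by_contra hlt
    exact H _ (not_le.1 hlt) t ht rfl
  intro i
  induction i with
  | zero => exact fun _ => h
  | succ i ih =>
    intro hi t ht hAt
    have h1 := hA (t - 1) (by omega)
    rw [sub_add_cancel, hAt] at h1
    obtain ⟨_, ⟨_, h2⟩ | ⟨_, h2⟩⟩ := h1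
    · omega
    · refine ih (by omega) (t - 1) (by omega) ?_
      unfold spineNext at h2
      split_ifs at h2 <;> omega

lemma IsPastPath.eq_cycleState (hp : 1 ≤ p) {x A : ℤ → ℕ} (hA : IsPastPath g n p x A)
    (h : ∀ t ≤ 0, A t ≠ 0) (h0 : A 0 < n + p) {t : ℤ} (ht : t ≤ 0) :
    A t = cycleState n p ((A 0 - n : ℕ) + t) := by
  induction t, ht using Int.leInductionDown with
  | base =>
    have := hA.le_of_ne_zero h le_rfl
    rw [add_zero, cycleState_natCast (by omega)]
    omega
  | pred t ht ih =>
    have h1 := hA (t - 1) (by omega)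
    rw [sub_add_cancel] at h1
    obtain ⟨h2, ⟨_, h3⟩ | ⟨_, h3⟩⟩ := h1
    · exact absurd h3 (h t ht)
    · refine eq_of_spineNext_eq (hA.le_of_ne_zero h (by omega)) (le_cycleState _) h2
        (cycleState_lt hp _) ?_
      rw [← h3, ih, spineNext_cycleState hp]
      congr 1
      ring

lemma IsPastPath.label_eq (hp : 1 ≤ p) {x A : ℤ → ℕ} (hA : IsPastPath g n p x A)
    (h : ∀ t ≤ 0, A t ≠ 0) (h0 : A 0 < n + p) {t : ℤ} (ht : t < 0) :
    x t = g (cycleState n p ((A 0 - n : ℕ) + t)) := by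
  obtain ⟨_, ⟨_, h3⟩ | ⟨h3, _⟩⟩ := hA t ht
  · exact absurd h3 (h (t + 1) (by omega))
  · rw [h3, hA.eq_cycleState hp h h0 ht.le]

lemma cycleState_add_mul (t : ℤ) (m : ℤ) : cycleState n p (t + p * m) = cycleState n p t := by
  simp [cycleState]

/-- Distinct states of the terminal cycle cannot have the same past when the period is minimal. -/
lemma IsPastPath.exists_zero (hp : 1 ≤ p) (hper : ∀ k, n ≤ k → g (k + p) = g k)
    (hmin : ∀ q, 1 ≤ q → (∀ k, n ≤ k → g (k + q) = g k) → p ≤ q) {x A B : ℤ → ℕ}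
    (hA : IsPastPath g n p x A) (hB : IsPastPath g n p x B) (hAB : A 0 ≠ B 0)
    (hA0 : A 0 < n + p) (hB0 : B 0 < n + p) (h : ∀ t ≤ 0, A t ≠ 0) : ∃ t ≤ 0, B t = 0 := by
  by_contra! hB'
  wlog hlt : A 0 < B 0 generalizing A B
  · exact this hB hA hAB.symm hB0 hA0 hB' h (by omega)
  have hA1 := hA.le_of_ne_zero h le_rfl
  have hmin' := hmin (B 0 - A 0) (by omega) fun k hk => by
    have key : ∀ s : ℤ, g (cycleState n p ((B 0 - A 0 : ℕ) + s)) = g (cycleState n p s) := by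
      intro s
      have hneg : s - (A 0 - n : ℕ) - p * (|s| + 1) < 0 := by
        have := le_abs_self s
        have : (1 : ℤ) * (|s| + 1) ≤ p * (|s| + 1) := by
          gcongr
          exact_mod_cast hp
        omega
      have h1 := hA.label_eq hp h hA0 hneg
      rw [hB.label_eq hp hB' hB0 hneg] at h1
      convert h1 using 2
      · rw [← cycleState_add_mul _ (-(|s| + 1))]
        congr 1
        push_cast [hlt.le, hA1, hA1.trans hlt.le]
        ring
      · rw [← cycleState_add_mul _ (-(|s| + 1))]
        congr 1
        ring
    have h1 := key ((k - n : ℕ) : ℤ)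
    rw [← Nat.cast_add, ← zero_add (((B 0 - A 0 + (k - n) : ℕ)) : ℤ),
      ← zero_add (((k - n : ℕ)) : ℤ), apply_cycleState_add hp hper, apply_cycleState_add hp hper]
      at h1
    have h0 : cycleState n p 0 = n := by simp [cycleState]
    rw [h0] at h1
    convert h1 using 2 <;> omega
  omega

end FischerGraph

section CompanionPath

/-- The word `g_1 ⋯ g_l` is read on the terminal cycle just before time `t`. -/
def PrefixEndsAt (g : ℕ → ℕ) (n p : ℕ) (t : ℤ) (l : ℕ) : Prop :=
  ∀ i < l, g (cycleState n p (t - l + i)) = g i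

open scoped Classical in
/-- The state at time `t` of the path with the same labels as the terminal cycle that visits the
initial state: the length of the longest prefix of `g` read just before time `t`. -/
noncomputable def companionState (g : ℕ → ℕ) (n p : ℕ) (t : ℤ) : ℕ :=
  Nat.findGreatest (PrefixEndsAt g n p t) (n + p)

variable {g : ℕ → ℕ} {n p : ℕ}

lemma prefixEndsAt_companionState (t : ℤ) :
    PrefixEndsAt g n p t (companionState g n p t) := by
  classical
  exact Nat.findGreatest_spec (P := PrefixEndsAt g n p t) (Nat.zero_le _) (by simp [PrefixEndsAt])

lemma PrefixEndsAt.lt (hn : 1 ≤ n) (hp : 1 ≤ p) (hper : ∀ k, n ≤ k → g (k + p) = g k)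
    (hnp : ∀ q, 1 ≤ q → ¬ ∀ k, g (k + q) = g k) {t : ℤ} {l : ℕ} (h : PrefixEndsAt g n p t l) :
    l < n + p := by
  by_contra! hl
  have hk := le_cycleState (n := n) (p := p) (t - l)
  refine hnp (cycleState n p (t - l)) (by omega) fun k => ?_
  rw [add_comm]
  induction k using Nat.strong_induction_on with
  | _ k ih =>
    by_cases hkl : k < n + p
    · rw [← apply_cycleState_add hp hper]
      exact h k (by omega)
    · obtain ⟨k, rfl⟩ := Nat.exists_eq_add_of_le' (show p ≤ k by omega)
      rw [← add_assoc, hper _ (by omega), hper _ (by omega)]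
      exact ih k (by omega)

lemma PrefixEndsAt.le_companionState (hn : 1 ≤ n) (hp : 1 ≤ p)
    (hper : ∀ k, n ≤ k → g (k + p) = g k)
    (hnp : ∀ q, 1 ≤ q → ¬ ∀ k, g (k + q) = g k) {t : ℤ} {l : ℕ} (h : PrefixEndsAt g n p t l) :
    l ≤ companionState g n p t := by
  classical
  exact Nat.le_findGreatest (h.lt hn hp hper hnp).le h

lemma prefixEndsAt_succ_iff {t : ℤ} {l : ℕ} :
    PrefixEndsAt g n p (t + 1) (l + 1) ↔
      PrefixEndsAt g n p t l ∧ g (cycleState n p t) = g l := by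
  have h1 : ∀ i : ℕ, t + 1 - ((l + 1 : ℕ) : ℤ) + i = t - l + i := by
    intro i
    push_cast
    ring
  simp only [PrefixEndsAt, h1, Nat.forall_lt_succ_right, sub_add_cancel]

lemma companionState_step_cases (hn : 1 ≤ n) (hp : 1 ≤ p)
    (hper : ∀ k, n ≤ k → g (k + p) = g k)
    (hlex : ∀ k m, (∀ i < m, g (k + i) = g i) → g (k + m) ≤ g m)
    (hnp : ∀ q, 1 ≤ q → ¬ ∀ k, g (k + q) = g k) (t : ℤ) :
    (g (cycleState n p t) < g (companionState g n p t) ∧ companionState g n p (t + 1) = 0) ∨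
      (g (cycleState n p t) = g (companionState g n p t) ∧
        companionState g n p (t + 1) = companionState g n p t + 1) := by
  set a := companionState g n p t with ha
  have hspec : PrefixEndsAt g n p t a := prefixEndsAt_companionState t
  have hmax : ∀ l, PrefixEndsAt g n p t l → l ≤ a := fun l h =>
    h.le_companionState hn hp hper hnp
  have hspec' := prefixEndsAt_companionState (g := g) (n := n) (p := p) (t + 1)
  have hle : g (cycleState n p t) ≤ g a := by
    have h1 := hlex (cycleState n p (t - a)) a fun i hi => by
      rw [← apply_cycleState_add hp hper]
      exact hspec i hi
    rwa [← apply_cycleState_add hp hper, sub_add_cancel] at h1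
  rcases hle.lt_or_eq with hlt | heq
  · refine Or.inl ⟨hlt, ?_⟩
    by_contra hne
    obtain ⟨l, hl⟩ := Nat.exists_eq_succ_of_ne_zero hne
    rw [hl, Nat.succ_eq_add_one, prefixEndsAt_succ_iff] at hspec'
    obtain ⟨e, he⟩ := Nat.exists_eq_add_of_le' (hmax l hspec'.1)
    have h1 := hlex e l fun i hi => by
      rw [← hspec (e + i) (by omega), ← hspec'.1 i hi]
      congr 2
      push_cast [he]
      ring
    rw [← he] at h1
    omega
  · refine Or.inr ⟨heq, le_antisymm ?_ ?_⟩
    · rcases Nat.eq_zero_or_eq_succ_pred (companionState g n p (t + 1)) with h0 | h0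
      · omega
      · rw [h0, Nat.succ_eq_add_one, prefixEndsAt_succ_iff] at hspec'
        have := hmax _ hspec'.1
        omega
    · exact (prefixEndsAt_succ_iff.2 ⟨hspec, heq⟩).le_companionState hn hp hper hnp

lemma companionState_lt_add (hn : 1 ≤ n) (hp : 1 ≤ p) (hper : ∀ k, n ≤ k → g (k + p) = g k)
    (hnp : ∀ q, 1 ≤ q → ¬ ∀ k, g (k + q) = g k) (t : ℤ) : companionState g n p t < n + p :=
  (prefixEndsAt_companionState t).lt hn hp hper hnp

lemma fischerStep_companionState (hn : 1 ≤ n) (hp : 1 ≤ p)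
    (hper : ∀ k, n ≤ k → g (k + p) = g k)
    (hlex : ∀ k m, (∀ i < m, g (k + i) = g i) → g (k + m) ≤ g m)
    (hnp : ∀ q, 1 ≤ q → ¬ ∀ k, g (k + q) = g k) (t : ℤ) :
    fischerStep g n p (g (cycleState n p t)) (companionState g n p t)
      (companionState g n p (t + 1)) := by
  have h1 := companionState_lt_add hn hp hper hnp (t + 1)
  refine ⟨companionState_lt_add hn hp hper hnp t, ?_⟩
  rcases companionState_step_cases hn hp hper hlex hnp t with h | h
  · exact Or.inl h
  · refine Or.inr ⟨h.1, ?_⟩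
    rw [spineNext, if_pos (by omega), h.2]

lemma companionState_add_period (t : ℤ) :
    companionState g n p (t + p) = companionState g n p t := by
  have h : PrefixEndsAt g n p (t + p) = PrefixEndsAt g n p t := by
    ext l
    have h1 : ∀ i : ℕ, t + p - (l : ℤ) + i = t - l + i + p := fun i => by ring
    simp only [PrefixEndsAt, h1, cycleState_add_period]
  unfold companionState
  congr!

lemma companionState_sub (hn : 1 ≤ n) (hp : 1 ≤ p) (hper : ∀ k, n ≤ k → g (k + p) = g k)
    (hlex : ∀ k m, (∀ i < m, g (k + i) = g i) → g (k + m) ≤ g m)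
    (hnp : ∀ q, 1 ≤ q → ¬ ∀ k, g (k + q) = g k) (t : ℤ) {i : ℕ}
    (hi : i ≤ companionState g n p t) :
    companionState g n p (t - i) = companionState g n p t - i := by
  induction i with
  | zero => simp
  | succ i ih =>
    have h1 := ih (by omega)
    have h2 := companionState_step_cases hn hp hper hlex hnp (t - (i + 1 : ℕ))
    have h3 : t - ((i + 1 : ℕ) : ℤ) + 1 = t - i := by
      push_cast
      ring
    rw [h3] at h2
    omega

lemma companionState_lt (hn : 1 ≤ n) (hp : 1 ≤ p) (hper : ∀ k, n ≤ k → g (k + p) = g k)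
    (hlex : ∀ k m, (∀ i < m, g (k + i) = g i) → g (k + m) ≤ g m)
    (hnp : ∀ q, 1 ≤ q → ¬ ∀ k, g (k + q) = g k) (t : ℤ) : companionState g n p t < p := by
  by_contra! h
  have h1 := companionState_sub hn hp hper hlex hnp t h
  rw [← companionState_add_period, sub_add_cancel] at h1
  omega

lemma companionState_ne_cycleState (hn : 1 ≤ n) (hp : 1 ≤ p)
    (hper : ∀ k, n ≤ k → g (k + p) = g k)
    (hlex : ∀ k m, (∀ i < m, g (k + i) = g i) → g (k + m) ≤ g m)
    (hnp : ∀ q, 1 ≤ q → ¬ ∀ k, g (k + q) = g k) (t : ℤ) :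
    companionState g n p t ≠ cycleState n p t := by
  intro h
  have key : ∀ s, t ≤ s → companionState g n p s = cycleState n p s := by
    intro s hs
    induction s, hs using Int.leInduction with
    | base => exact h
    | succ s hs ih =>
      have h1 := fischerStep_companionState hn hp hper hlex hnp s
      rw [ih] at h1
      exact fischerStep_unique h1 (fischerStep_cycleState hp s)
  have h1 := companionState_sub hn hp hper hlex hnp (t + p) le_rfl
  have h2 := companionState_lt hn hp hper hlex hnp (t + p)
  rw [key _ (by omega)] at h1
  have h3 := le_cycleState (n := n) (p := p) (t + p - (companionState g n p (t + p) : ℕ))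
  omega

/-- The pairs formed by the cycle and its companion never occur in both orders. -/
lemma companionState_cycleState_no_swap (hn : 1 ≤ n) (hp : 1 ≤ p)
    (hper : ∀ k, n ≤ k → g (k + p) = g k)
    (hlex : ∀ k m, (∀ i < m, g (k + i) = g i) → g (k + m) ≤ g m)
    (hnp : ∀ q, 1 ≤ q → ¬ ∀ k, g (k + q) = g k) (hpre : g (n - 1 + p) ≠ g (n - 1)) {j k : ℕ}
    (hj : j < p) (hk : k < p) (h1 : companionState g n p j = cycleState n p k)
    (h2 : companionState g n p k = cycleState n p j) : False := by
  wlog hjk : j ≤ k generalizing j k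
  · exact this hk hj h2 h1 (by omega)
  have hjk' : j ≠ k := by
    rintro rfl
    exact companionState_ne_cycleState hn hp hper hlex hnp _ h1
  rw [cycleState_natCast hk] at h1
  rw [cycleState_natCast hj] at h2
  have h3 := prefixEndsAt_companionState (g := g) (n := n) (p := p) j
  have h4 := prefixEndsAt_companionState (g := g) (n := n) (p := p) k
  rw [h1] at h3
  rw [h2] at h4
  have h5 := h3 (n - 1 + (k - j)) (by omega)
  have h6 := h4 (n - 1) (by omega)
  have e1 : (j : ℤ) - ((n + k : ℕ) : ℤ) + ((n - 1 + (k - j) : ℕ) : ℤ) = ((p - 1 : ℕ) : ℤ) - p := by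
    omega
  have e2 : (k : ℤ) - ((n + j : ℕ) : ℤ) + ((n - 1 : ℕ) : ℤ) = ((k - j - 1 : ℕ) : ℤ) := by
    omega
  rw [e1, ← cycleState_add_period, sub_add_cancel, cycleState_natCast (by omega)] at h5
  rw [e2, cycleState_natCast (by omega)] at h6
  apply hpre
  rw [← h6, show n - 1 + p = n + (p - 1) by omega, h5]
  congr 1
  omega

/-- An unmerged past path accompanying one that stays in the terminal cycle is the companion. -/
lemma IsPastPath.eq_companionState (hn : 1 ≤ n) (hp : 1 ≤ p)
    (hper : ∀ k, n ≤ k → g (k + p) = g k)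
    (hlex : ∀ k m, (∀ i < m, g (k + i) = g i) → g (k + m) ≤ g m)
    (hnp : ∀ q, 1 ≤ q → ¬ ∀ k, g (k + q) = g k)
    (hmin : ∀ q, 1 ≤ q → (∀ k, n ≤ k → g (k + q) = g k) → p ≤ q) {x A B : ℤ → ℕ}
    (hA : IsPastPath g n p x A) (hB : IsPastPath g n p x B) (hAB : A 0 ≠ B 0)
    (hA0 : A 0 < n + p) (hB0 : B 0 < n + p) (h : ∀ t ≤ 0, A t ≠ 0) :
    B 0 = companionState g n p (A 0 - n : ℕ) := by
  obtain ⟨t, ht, hBt⟩ := hA.exists_zero hp hper hmin hB hAB hA0 hB0 h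
  by_contra hne
  set c : ℤ := ((A 0 - n : ℕ) : ℤ) with hc
  have hC : IsPastPath g n p x fun s => companionState g n p (c + s) := by
    intro s hs
    rw [hA.label_eq hp h hA0 hs]
    have h1 := fischerStep_companionState hn hp hper hlex hnp (c + s)
    rwa [add_assoc] at h1
  have h1 := companionState_sub hn hp hper hlex hnp c le_rfl
  refine hB.not_both_zero hn hper hlex hC (by simpa using hne) ht
    (t := -(companionState g n p c : ℕ)) (by omega) hBt ?_
  simpa [sub_eq_add_neg] using h1

end CompanionPath

section FiberProduct

variable {g : ℕ → ℕ} {n p : ℕ}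

lemma exists_fpEdge_path (hn : 1 ≤ n) (hp : 1 ≤ p)
    (hper : ∀ k, n ≤ k → g (k + p) = g k)
    (hlex : ∀ k m, (∀ i < m, g (k + i) = g i) → g (k + m) ≤ g m)
    (hnp : ∀ q, 1 ≤ q → ¬ ∀ k, g (k + q) = g k) (t : ℤ) :
    ∃ (w : ℤ → ℕ × ℕ) (x : ℤ → ℕ),
      w 0 = (cycleState n p t + 1, companionState g n p t + 1) ∧
        ∀ i : ℤ, fpEdge g n p (x i) (w i) (w (i + 1)) := by
  refine ⟨fun s => (cycleState n p (t + s) + 1, companionState g n p (t + s) + 1),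
    fun s => g (cycleState n p (t + s)), by simp, fun i => ⟨?_, ?_⟩⟩
  · rw [fischerEdge_succ_iff, ← add_assoc]
    exact fischerStep_cycleState hp _
  · rw [fischerEdge_succ_iff, ← add_assoc]
    exact fischerStep_companionState hn hp hper hlex hnp _

lemma fpEdge.swap {a : ℕ} {u v : ℕ × ℕ} (h : fpEdge g n p a u v) :
    fpEdge g n p a u.swap v.swap := ⟨h.2, h.1⟩

/-- The off-diagonal vertices on bi-infinite paths of the fiber product graph, for a
lexicographically shift-maximal sequence `g` that is eventually but not purely periodic. -/
lemma offDiagonal_eq (hn : 1 ≤ n) (hp : 1 ≤ p)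
    (hper : ∀ k, n ≤ k → g (k + p) = g k)
    (hlex : ∀ k m, (∀ i < m, g (k + i) = g i) → g (k + m) ≤ g m)
    (hnp : ∀ q, 1 ≤ q → ¬ ∀ k, g (k + q) = g k)
    (hmin : ∀ q, 1 ≤ q → (∀ k, n ≤ k → g (k + q) = g k) → p ≤ q) :
    { q : ℕ × ℕ | q.1 ≠ q.2 ∧ ∃ (w : ℤ → ℕ × ℕ) (x : ℤ → ℕ),
        w 0 = q ∧ ∀ i : ℤ, fpEdge g n p (x i) (w i) (w (i + 1)) } =
      ↑((Finset.range p).image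
          (fun j : ℕ => (cycleState n p j + 1, companionState g n p j + 1)) ∪
        (Finset.range p).image
          (fun j : ℕ => (companionState g n p j + 1, cycleState n p j + 1))) := by
  ext ⟨u, v⟩
  simp only [Set.mem_ofPred_eq, Finset.coe_union, Finset.coe_image, Set.mem_union, Set.mem_image,
    Finset.coe_range, Set.mem_Iio]
  constructor
  · rintro ⟨huv, w, x, hw, hpath⟩
    have hA : IsPastPath g n p x fun t => (w t).1 - 1 := fun t _ =>
      fischerStep_of_fischerEdge (hpath t).1
    have hB : IsPastPath g n p x fun t => (w t).2 - 1 := fun t _ =>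
      fischerStep_of_fischerEdge (hpath t).2
    have hu := (hpath 0).1
    have hv := (hpath 0).2
    rw [hw] at hu hv
    have hu1 : 1 ≤ u := hu.1
    have hu2 : u ≤ n + p := hu.2.1
    have hv1 : 1 ≤ v := hv.1
    have hv2 : v ≤ n + p := hv.2.1
    have hne : (w 0).1 - 1 ≠ (w 0).2 - 1 := by
      simp only [hw]
      omega
    by_cases hz : ∀ t ≤ 0, (w t).1 - 1 ≠ 0
    · have h1 := hA.eq_companionState hn hp hper hlex hnp hmin hB hne
        (by simp only [hw]; omega) (by simp only [hw]; omega) hz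
      have h2 := hA.le_of_ne_zero hz le_rfl
      simp only [hw] at h1 h2
      refine Or.inl ⟨u - 1 - n, by omega, ?_⟩
      rw [cycleState_natCast (by omega), ← h1]
      ext <;> dsimp only <;> omega
    · push Not at hz
      obtain ⟨s, hs, hs0⟩ := hz
      have hz' : ∀ t ≤ 0, (w t).2 - 1 ≠ 0 := fun t ht ht0 =>
        hA.not_both_zero hn hper hlex hB hne hs ht hs0 ht0
      have h1 := hB.eq_companionState hn hp hper hlex hnp hmin hA hne.symm
        (by simp only [hw]; omega) (by simp only [hw]; omega) hz'
      have h2 := hB.le_of_ne_zero hz' le_rfl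
      simp only [hw] at h1 h2
      refine Or.inr ⟨v - 1 - n, by omega, ?_⟩
      rw [cycleState_natCast (by omega), ← h1]
      ext <;> dsimp only <;> omega
  · rintro (⟨j, hj, h⟩ | ⟨j, hj, h⟩) <;> obtain ⟨rfl, rfl⟩ := Prod.mk.inj h
    · have := companionState_ne_cycleState hn hp hper hlex hnp j
      exact ⟨by omega, exists_fpEdge_path hn hp hper hlex hnp j⟩
    · have := companionState_ne_cycleState hn hp hper hlex hnp j
      obtain ⟨w, x, hw, hpath⟩ := exists_fpEdge_path hn hp hper hlex hnp j
      exact ⟨by omega, fun t => (w t).swap, x, by simp [hw], fun i => (hpath i).swap⟩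

end FiberProduct

/-- fiber product cover structure: for `g(β)` eventually periodic but not
periodic with minimal `n ≥ 1`, `p ≥ 1`, the set of off-diagonal vertices of the fiber
product graph lying on a bi-infinite path has exactly `2p` elements. -/
theorem statement13 (β : ℝ) (hβ : 1 < β) (n p : ℕ) (hn : 1 ≤ n) (hp : 1 ≤ p)
    (hper : ∀ k, n ≤ k → genSeq β (k + p) = genSeq β k)
    (hmin : ∀ n' p' : ℕ, 1 ≤ p' →
      (∀ k, n' ≤ k → genSeq β (k + p') = genSeq β k) → n ≤ n' ∧ p ≤ p') :
    { q : ℕ × ℕ | q.1 ≠ q.2 ∧ ∃ (w : ℤ → ℕ × ℕ) (x : ℤ → ℕ),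
        w 0 = q ∧ ∀ i : ℤ, fpEdge (genSeq β) n p (x i) (w i) (w (i + 1)) }.ncard
      = 2 * p := by
  have hnp : ∀ q, 1 ≤ q → ¬ ∀ k, genSeq β (k + q) = genSeq β k := fun q hq h => by
    have := (hmin 0 q hq fun k _ => h k).1
    omega
  have hlex : ∀ k m, (∀ i < m, genSeq β (k + i) = genSeq β i) → genSeq β (k + m) ≤ genSeq β m := by
    rw [genSeq_eq_betaDigit hnp]
    exact betaDigit_one_le_of_prefix (by linarith)
  have hpre : genSeq β (n - 1 + p) ≠ genSeq β (n - 1) := fun h => by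
    have := (hmin (n - 1) p hp fun k hk => by
      rcases hk.eq_or_lt with rfl | hk
      · exact h
      · exact hper k (by omega)).1
    omega
  rw [offDiagonal_eq hn hp hper hlex hnp fun q hq h => (hmin n q hq h).2, Set.ncard_coe_finset,
    Finset.card_union_of_disjoint, Finset.card_image_of_injOn, Finset.card_image_of_injOn,
    Finset.card_range, two_mul]
  · intro j hj k hk h
    simp only [Finset.coe_range, Set.mem_Iio] at hj hk
    simp only [Prod.mk.injEq, cycleState_natCast hj, cycleState_natCast hk] at h
    omega
  · intro j hj k hk h
    simp only [Finset.coe_range, Set.mem_Iio] at hj hk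
    simp only [Prod.mk.injEq, cycleState_natCast hj, cycleState_natCast hk] at h
    omega
  · rw [Finset.disjoint_left]
    intro q hq hq'
    simp only [Finset.mem_image, Finset.mem_range] at hq hq'
    obtain ⟨j, hj, rfl⟩ := hq
    obtain ⟨k, hk, h⟩ := hq'
    simp only [Prod.mk.injEq, Nat.add_right_cancel_iff] at h
    exact companionState_cycleState_no_swap hn hp hper hlex hnp hpre hj hk h.2.symm h.1
end

section
/- Bowen–Franks data of SFT beta-shifts: let β > 1 have periodic generating sequence g(β) = (g_1 ⋯ g_p)^∞ with p minimal, and set S = g_1 + ⋯ + g_p. Let A be the p × p integer matrix with A_{i,1} = g_i for 1 ≤ i ≤ p−1, A_{p,1} = g_p + 1, A_{i,i+1} = 1 for 1 ≤ i ≤ p−1, and all other entries 0. Then the quotient group ℤ^p / { v·(I − A) : v ∈ ℤ^p } is isomorphic as an abelian group to ℤ/Sℤ, and det(I − A) = −S. -/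
/-- The matrix of the right Fischer cover of a shift with generating sequence `(g_0 ⋯ g_n)^∞`. -/
def coverMatrix (n : ℕ) (g : ℕ → ℤ) : Matrix (Fin (n + 1)) (Fin (n + 1)) ℤ :=
  Matrix.of fun i j =>
    (if (j : ℕ) = 0 then g i + (if (i : ℕ) = n then 1 else 0) else 0)
      + (if (j : ℕ) = (i : ℕ) + 1 then 1 else 0)

namespace coverMatrix

/-- The class of the `i`-th basis vector in the cokernel, as a multiple of the class of the
first one. -/
def weight (n : ℕ) (g : ℕ → ℤ) (i : Fin (n + 1)) : ℤ :=
  1 - ∑ k ∈ Finset.range i, g k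

variable {n : ℕ} {g : ℕ → ℤ}

lemma apply_castSucc_zero (i : Fin n) : coverMatrix n g i.castSucc 0 = g i := by
  have := i.isLt
  simp [coverMatrix]
  omega

lemma apply_last_zero : coverMatrix n g (Fin.last n) 0 = g n + 1 := by
  simp [coverMatrix]

lemma apply_succ (i : Fin (n + 1)) (j : Fin n) :
    coverMatrix n g i j.succ = if j.castSucc = i then 1 else 0 := by
  simp only [coverMatrix, Matrix.of_apply, Fin.val_succ, Fin.ext_iff, Fin.val_castSucc]
  simp

lemma weight_zero : weight n g 0 = 1 := by simp [weight]

lemma one_sub_mulVec_weight :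
    (1 - coverMatrix n g).mulVec (weight n g) =
      Pi.single (Fin.last n) (-∑ k ∈ Finset.range (n + 1), g k) := by
  ext i
  rw [Matrix.sub_mulVec, Matrix.one_mulVec, Pi.sub_apply, Matrix.mulVec, dotProduct,
    Fin.sum_univ_succ]
  simp only [apply_succ, weight_zero]
  induction i using Fin.lastCases with
  | last =>
    simp [apply_last_zero, weight, Finset.sum_range_succ, (Fin.castSucc_lt_last _).ne]
    ring
  | cast i =>
    simp [apply_castSucc_zero, weight, Finset.sum_range_succ, (Fin.castSucc_lt_last _).ne]
    ring

lemma vecMul_one_sub_apply_succ (v : Fin (n + 1) → ℤ) (j : Fin n) :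
    Matrix.vecMul v (1 - coverMatrix n g) j.succ = v j.succ - v j.castSucc := by
  rw [Matrix.vecMul_sub, Matrix.vecMul_one, Pi.sub_apply, Matrix.vecMul, dotProduct]
  simp [apply_succ]

lemma vecMul_one_sub_dotProduct_weight (v : Fin (n + 1) → ℤ) :
    Matrix.vecMul v (1 - coverMatrix n g) ⬝ᵥ weight n g =
      -(v (Fin.last n) * ∑ k ∈ Finset.range (n + 1), g k) := by
  rw [← Matrix.dotProduct_mulVec, one_sub_mulVec_weight, dotProduct_single, mul_neg]

lemma mem_range_vecMulLinear_iff (w : Fin (n + 1) → ℤ) :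
    w ∈ LinearMap.range (Matrix.vecMulLinear (1 - coverMatrix n g)) ↔
      ∑ k ∈ Finset.range (n + 1), g k ∣ w ⬝ᵥ weight n g := by
  constructor
  · rintro ⟨v, rfl⟩
    rw [Matrix.vecMulLinear_apply, vecMul_one_sub_dotProduct_weight]
    exact (Dvd.intro_left _ rfl).neg_right
  · rintro ⟨m, hm⟩
    let v : Fin (n + 1) → ℤ := fun j => -m - ∑ k ∈ Finset.Ioi j, w k
    have hv (j : Fin n) : Matrix.vecMul v (1 - coverMatrix n g) j.succ = w j.succ := by
      have : Finset.Ioi j.castSucc = insert j.succ (Finset.Ioi j.succ) := by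
        ext k
        simp only [Finset.mem_Ioi, Finset.mem_insert, Fin.lt_def, Fin.ext_iff, Fin.val_succ,
          Fin.val_castSucc]
        omega
      rw [vecMul_one_sub_apply_succ]
      simp only [v, this]
      rw [Finset.sum_insert (by simp)]
      ring
    have hlast : v (Fin.last n) = -m := by
      simp only [v, sub_eq_self]
      exact Finset.sum_eq_zero fun k hk => absurd (Finset.mem_Ioi.1 hk) (Fin.le_last k).not_gt
    have hdot := vecMul_one_sub_dotProduct_weight (g := g) v
    rw [hlast, neg_mul, neg_neg, mul_comm, ← hm, dotProduct, dotProduct, Fin.sum_univ_succ,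
      Fin.sum_univ_succ] at hdot
    simp only [hv, weight_zero, mul_one, add_left_inj] at hdot
    exact ⟨v, funext fun j => j.cases hdot hv⟩

lemma adjugate_one_sub_apply_zero_last :
    (1 - coverMatrix n g).adjugate 0 (Fin.last n) = 1 := by
  have htri : ((1 - coverMatrix n g).submatrix Fin.castSucc Fin.succ).IsLowerTriangular := by
    intro i j hij
    have hij : i < j := hij
    have h : i.castSucc ≠ j.succ := (Fin.castSucc_lt_succ_iff.2 hij.le).ne
    simp [apply_succ, h, hij.ne']
  rw [Matrix.adjugate_fin_succ_eq_det_submatrix, Fin.succAbove_last, Fin.succAbove_zero,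
    Matrix.det_of_isLowerTriangular _ htri]
  simp [apply_succ, (Fin.castSucc_lt_succ).ne, ← mul_pow]

lemma det_one_sub :
    (1 - coverMatrix n g).det = -∑ k ∈ Finset.range (n + 1), g k := by
  have h := congrArg (fun v => (1 - coverMatrix n g).adjugate.mulVec v 0)
    (one_sub_mulVec_weight (n := n) (g := g))
  simpa [Matrix.mulVec_mulVec, Matrix.adjugate_mul, Matrix.smul_mulVec, weight_zero,
    adjugate_one_sub_apply_zero_last, Matrix.mulVec_single] using h

lemma nonempty_cokernel_equiv_zmod (S : ℕ) (hS : (S : ℤ) = ∑ k ∈ Finset.range (n + 1), g k) :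
    Nonempty (((Fin (n + 1) → ℤ) ⧸
      LinearMap.range (Matrix.vecMulLinear (1 - coverMatrix n g))) ≃+ ZMod S) := by
  let φ : (Fin (n + 1) → ℤ) →+ ZMod S :=
    { toFun := fun w => ((w ⬝ᵥ weight n g : ℤ) : ZMod S)
      map_zero' := by simp
      map_add' := fun v w => by rw [add_dotProduct, Int.cast_add] }
  have hφ : Function.Surjective φ := fun x => by
    obtain ⟨m, rfl⟩ := ZMod.intCast_surjective x
    exact ⟨Pi.single 0 m, by simp [φ, weight_zero]⟩
  have hker : (LinearMap.range (Matrix.vecMulLinear (1 - coverMatrix n g))).toAddSubgroup =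
      φ.ker := by
    ext w
    rw [Submodule.mem_toAddSubgroup, mem_range_vecMulLinear_iff, AddMonoidHom.mem_ker, ← hS]
    exact (ZMod.intCast_zmod_eq_zero_iff_dvd _ _).symm
  exact ⟨(QuotientAddGroup.quotientAddEquivOfEq hker).trans
    (QuotientAddGroup.quotientKerEquivOfSurjective φ hφ)⟩

end coverMatrix

/-- Bowen–Franks data of SFT beta-shifts: if `g(β) = (g_1 ⋯ g_p)^∞` with
`p` minimal and `S = g_1 + ⋯ + g_p`, and `A` is the adjacency matrix of the Fischer cover,
then `ℤ^p / ℤ^p(I − A) ≅ ℤ/Sℤ` and `det(I − A) = −S`. -/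
theorem statement14 (β : ℝ) (hβ : 1 < β) (p : ℕ) (hp : 1 ≤ p)
    (hper : ∀ k, genSeq β (k + p) = genSeq β k)
    (hmin : ∀ q : ℕ, 1 ≤ q → (∀ k, genSeq β (k + q) = genSeq β k) → p ≤ q)
    (S : ℕ) (hS : S = ∑ i ∈ Finset.range p, genSeq β i)
    (A : Matrix (Fin p) (Fin p) ℤ)
    (hA : ∀ i j : Fin p, A i j =
      (if (j : ℕ) = 0 then
        (genSeq β (i : ℕ) : ℤ) + (if (i : ℕ) = p - 1 then 1 else 0) else 0)
      + (if (j : ℕ) = (i : ℕ) + 1 then 1 else 0)) :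
    Nonempty (((Fin p → ℤ) ⧸ LinearMap.range (Matrix.vecMulLinear (1 - A))) ≃+ ZMod S) ∧
      (1 - A).det = -(S : ℤ) := by
  obtain ⟨n, rfl⟩ : ∃ n, p = n + 1 := ⟨p - 1, by omega⟩
  obtain rfl : A = coverMatrix n fun k => (genSeq β k : ℤ) := by
    ext i j
    rw [hA]
    rfl
  have hS' : (S : ℤ) = ∑ k ∈ Finset.range (n + 1), (genSeq β k : ℤ) := by
    rw [hS, Nat.cast_sum]
  exact ⟨coverMatrix.nonempty_cokernel_equiv_zmod S hS', by rw [coverMatrix.det_one_sub, hS']⟩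
end

section
/- Bowen–Franks group of the fiber product cover: let β > 1 have generating sequence g(β) that is eventually periodic but not periodic, with n ≥ 1 and p ≥ 1 minimal such that g(β) = g_1 ⋯ g_n (g_{n+1} ⋯ g_{n+p})^∞, and set S = g_{n+1} + ⋯ + g_{n+p}. Let A_P be the (n+3p) × (n+3p) integer matrix, with indices split as {1,…,n+p} ∪ {1',…,p'} ∪ {1'',…,p''}, whose entries are all 0 except: (A_P)_{i,1} += g_i for 1 ≤ i ≤ n+p, (A_P)_{i,i+1} += 1 for 1 ≤ i ≤ n+p−1, (A_P)_{n+p,n+1} += 1; for each 1 ≤ j ≤ p, (A_P)_{j',1} += g_{n+j}, (A_P)_{j',(j+1)'} += 1 for j < p, (A_P)_{p',1'} += 1; and likewise (A_P)_{j'',1} += g_{n+j}, (A_P)_{j'',(j+1)''} += 1 for j < p, (A_P)_{p'',1''} += 1. Then ℤ^{n+3p} / { v·(I − A_P) : v ∈ ℤ^{n+3p} } is isomorphic as an abelian group to (ℤ/Sℤ) ⊕ ℤ ⊕ ℤ. -/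
open Finset in
/-- Telescoping along a path whose vertices also have `g k` edges to the vertex `x₀`. -/
lemma eq_sub_sum_zsmul_of_step {Q : Type*} [AddCommGroup Q] (g : ℕ → ℤ) (x : ℕ → Q) (x₀ : Q)
    (m : ℕ) (h : ∀ k < m, x k = g k • x₀ + x (k + 1)) (k : ℕ) (hk : k ≤ m) :
    x k = x 0 - (∑ i ∈ range k, g i) • x₀ := by
  induction k with
  | zero => simp
  | succ k ih =>
    have h1 := h k hk
    rw [ih (by omega)] at h1
    rw [sum_range_succ, add_smul, ← sub_sub, h1]
    abel

/-- A cokernel presented by generators `q i` with relations `q i = γ i • q z + q (s i)`: if every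
generator is an explicit combination of `q z`, `q y₁`, `q y₂`, and `S • q z = 0`, the cokernel is
`ZMod S × ℤ × ℤ` as soon as the coefficients respect the relations. -/
lemma nonempty_quotient_addEquiv_of_coeffs {ι : Type*} [Fintype ι] [DecidableEq ι]
    (B : Matrix ι ι ℤ) (S : ℕ) (a b c : ι → ℤ) (z y₁ y₂ : ι)
    (ha : ∀ i, (S : ℤ) ∣ ∑ j, B i j * a j) (hb : ∀ i, ∑ j, B i j * b j = 0)
    (hc : ∀ i, ∑ j, B i j * c j = 0)
    (hz : a z = 1 ∧ b z = 0 ∧ c z = 0) (hy₁ : a y₁ = 0 ∧ b y₁ = 1 ∧ c y₁ = 0)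
    (hy₂ : a y₂ = 0 ∧ b y₂ = 0 ∧ c y₂ = 1)
    (hS : (S : ℤ) • (LinearMap.range (Matrix.vecMulLinear B)).mkQ (Pi.single z 1) = 0)
    (hq : ∀ i, (LinearMap.range (Matrix.vecMulLinear B)).mkQ (Pi.single i 1) =
      a i • (LinearMap.range (Matrix.vecMulLinear B)).mkQ (Pi.single z 1) +
      b i • (LinearMap.range (Matrix.vecMulLinear B)).mkQ (Pi.single y₁ 1) +
      c i • (LinearMap.range (Matrix.vecMulLinear B)).mkQ (Pi.single y₂ 1)) :
    Nonempty (((ι → ℤ) ⧸ LinearMap.range (Matrix.vecMulLinear B)) ≃+ (ZMod S × ℤ × ℤ)) := by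
  set R := LinearMap.range (Matrix.vecMulLinear B) with hR
  let f : (ι → ℤ) →ₗ[ℤ] ZMod S × ℤ × ℤ :=
    Fintype.linearCombination ℤ fun i => ((a i : ZMod S), b i, c i)
  have hf (v : ι → ℤ) :
      f v = (((∑ i, v i * a i : ℤ) : ZMod S), ∑ i, v i * b i, ∑ i, v i * c i) := by
    simp [f, Fintype.linearCombination_apply, Prod.ext_iff, Prod.fst_sum, Prod.snd_sum]
  have hle : R ≤ LinearMap.ker f := by
    rw [hR, LinearMap.range_le_ker_iff]
    refine LinearMap.pi_ext' fun i => LinearMap.ext_ring ?_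
    simp only [LinearMap.comp_apply, LinearMap.single_apply, Matrix.vecMulLinear_apply,
      Matrix.single_one_vecMul, hf, Matrix.row, hb, hc]
    rw [(ZMod.intCast_zmod_eq_zero_iff_dvd _ S).2 (ha i)]
    rfl
  have hge : LinearMap.ker f ≤ R := by
    intro v hv
    rw [LinearMap.mem_ker, hf, Prod.mk_eq_zero, Prod.mk_eq_zero] at hv
    obtain ⟨h1, h2, h3⟩ := hv
    obtain ⟨t, ht⟩ := (ZMod.intCast_zmod_eq_zero_iff_dvd _ S).1 h1
    rw [← Submodule.ker_mkQ R, LinearMap.mem_ker]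
    have hv : R.mkQ v = ∑ i, v i • R.mkQ (Pi.single i 1) := by
      conv_lhs => rw [pi_eq_sum_univ' v]
      rw [map_sum]
      refine Finset.sum_congr rfl fun i _ => ?_
      rw [map_smul]
    rw [hv, Finset.sum_congr rfl fun i _ => congrArg (v i • ·) (hq i)]
    simp only [smul_add, smul_smul, Finset.sum_add_distrib, ← Finset.sum_smul, h2, h3, ht]
    rw [mul_comm, mul_smul, hS]
    simp
  have hsurj : Function.Surjective f := by
    rintro ⟨x, y, w⟩
    obtain ⟨x, rfl⟩ := ZMod.intCast_surjective x
    refine ⟨x • Pi.single z 1 + y • Pi.single y₁ 1 + w • Pi.single y₂ 1, ?_⟩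
    simp only [map_add, map_smul, f, Fintype.linearCombination_apply_single, hz, hy₁, hy₂]
    simp
  have hker : R = LinearMap.ker f := le_antisymm hle hge
  exact ⟨((Submodule.quotEquivOfEq _ _ hker).trans
    (f.quotKerEquivOfSurjective hsurj)).toAddEquiv⟩

/-- The number of edges from the vertex `i` of the fiber product cover that return to the start
vertex `0`. -/
def coverReturn (g : ℕ → ℤ) (n p i : ℕ) : ℤ :=
  if i < n + p then g i else if i < n + 2 * p then g (n + (i - (n + p)))
    else g (n + (i - (n + 2 * p)))

/-- The successor of the vertex `i` in the fiber product cover. -/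
def coverSucc (n p i : ℕ) : ℕ :=
  if i = n + p - 1 then n else if i = n + 2 * p - 1 then n + p
    else if i = n + 3 * p - 1 then n + 2 * p else i + 1

/-- The coefficient of the vertex `0` in the class of the vertex `i`. -/
def coverCoeff (g : ℕ → ℤ) (n p i : ℕ) : ℤ :=
  if i < n + p then 1 - ∑ k ∈ Finset.range i, g k
    else if i < n + 2 * p then - ∑ k ∈ Finset.range (i - (n + p)), g (n + k)
    else - ∑ k ∈ Finset.range (i - (n + 2 * p)), g (n + k)

lemma coverSucc_lt {n p i : ℕ} (hp : 1 ≤ p) (hi : i < n + 3 * p) :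
    coverSucc n p i < n + 3 * p := by
  unfold coverSucc
  split_ifs <;> omega

open Finset in
lemma dvd_coverCoeff_sub (g : ℕ → ℤ) (n p : ℕ) (hp : 1 ≤ p) (i : ℕ) (hi : i < n + 3 * p) :
    (∑ i ∈ range p, g (n + i)) ∣
      coverCoeff g n p i - coverReturn g n p i - coverCoeff g n p (coverSucc n p i) := by
  obtain ⟨m, rfl⟩ : ∃ m, p = m + 1 := ⟨p - 1, by omega⟩
  by_cases h1 : i < n + (m + 1)
  · by_cases h2 : i = n + m
    · subst h2
      have h3 : coverSucc n (m + 1) (n + m) = n := if_pos rfl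
      have h4 := sum_range_succ g (n + m)
      rw [add_assoc, sum_range_add] at h4
      simp only [h3, coverCoeff, coverReturn, h1, if_true, show n < n + (m + 1) by omega]
      exact ⟨-1, by linarith⟩
    · have h3 : coverSucc n (m + 1) i = i + 1 := by
        unfold coverSucc
        split_ifs <;> omega
      simp only [h3, coverCoeff, coverReturn, h1, if_true, show i + 1 < n + (m + 1) by omega,
        sum_range_succ]
      exact ⟨0, by ring⟩
  by_cases h2 : i < n + 2 * (m + 1)
  · obtain ⟨k, rfl⟩ := Nat.exists_eq_add_of_le (not_lt.1 h1)
    by_cases h4 : k = m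
    · subst h4
      have h3 : coverSucc n (k + 1) (n + (k + 1) + k) = n + (k + 1) := by
        unfold coverSucc
        split_ifs <;> omega
      simp only [h3, coverCoeff, coverReturn, h1, h2, if_true, if_false, lt_irrefl,
        show n + (k + 1) < n + 2 * (k + 1) by omega, Nat.add_sub_cancel_left, Nat.sub_self,
        sum_range_succ, sum_range_zero]
      exact ⟨-1, by ring⟩
    · have h3 : coverSucc n (m + 1) (n + (m + 1) + k) = n + (m + 1) + (k + 1) := by
        unfold coverSucc
        split_ifs <;> omega
      simp only [h3, coverCoeff, coverReturn, h1, h2, if_true, if_false,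
        show ¬ n + (m + 1) + (k + 1) < n + (m + 1) by omega,
        show n + (m + 1) + (k + 1) < n + 2 * (m + 1) by omega, Nat.add_sub_cancel_left,
        sum_range_succ]
      exact ⟨0, by ring⟩
  · obtain ⟨k, rfl⟩ := Nat.exists_eq_add_of_le (not_lt.1 h2)
    by_cases h4 : k = m
    · subst h4
      have h3 : coverSucc n (k + 1) (n + 2 * (k + 1) + k) = n + 2 * (k + 1) := by
        unfold coverSucc
        split_ifs <;> omega
      simp only [h3, coverCoeff, coverReturn, h1, h2, if_false, lt_irrefl,
        show ¬ n + 2 * (k + 1) < n + (k + 1) by omega, Nat.add_sub_cancel_left, Nat.sub_self,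
        sum_range_succ, sum_range_zero]
      exact ⟨-1, by ring⟩
    · have h3 : coverSucc n (m + 1) (n + 2 * (m + 1) + k) = n + 2 * (m + 1) + (k + 1) := by
        unfold coverSucc
        split_ifs <;> omega
      simp only [h3, coverCoeff, coverReturn, h1, h2, if_false,
        show ¬ n + 2 * (m + 1) + (k + 1) < n + (m + 1) by omega,
        show ¬ n + 2 * (m + 1) + (k + 1) < n + 2 * (m + 1) by omega, Nat.add_sub_cancel_left,
        sum_range_succ]
      exact ⟨0, by ring⟩

open Finset in
lemma cover_relations {Q : Type*} [AddCommGroup Q] (q : ℕ → Q) (g : ℕ → ℤ) (n p : ℕ)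
    (hp : 1 ≤ p)
    (hstep : ∀ k < n + 3 * p, q k = coverReturn g n p k • q 0 + q (coverSucc n p k)) :
    (∑ i ∈ range p, g (n + i)) • q 0 = 0 ∧
      ∀ i < n + 3 * p, q i = coverCoeff g n p i • q 0 +
        (if n + p ≤ i ∧ i < n + 2 * p then 1 else 0 : ℤ) • q (n + p) +
        (if n + 2 * p ≤ i then 1 else 0 : ℤ) • q (n + 2 * p) := by
  obtain ⟨m, rfl⟩ : ∃ m, p = m + 1 := ⟨p - 1, by omega⟩
  have hseg₀ : ∀ k ≤ n + m, q k = q 0 - (∑ i ∈ range k, g i) • q 0 := by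
    refine eq_sub_sum_zsmul_of_step g q (q 0) _ fun k hk => ?_
    rw [hstep k (by omega), coverReturn, coverSucc, if_pos (by omega), if_neg (by omega),
      if_neg (by omega), if_neg (by omega)]
  have hseg₁ : ∀ k ≤ m,
      q (n + (m + 1) + k) = q (n + (m + 1)) - (∑ i ∈ range k, g (n + i)) • q 0 := by
    refine eq_sub_sum_zsmul_of_step (fun i => g (n + i)) (fun k => q (n + (m + 1) + k)) (q 0) _
      fun k hk => ?_
    rw [hstep _ (by omega), coverReturn, coverSucc, if_neg (by omega), if_pos (by omega),
      if_neg (by omega), if_neg (by omega), if_neg (by omega), Nat.add_sub_cancel_left,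
      add_assoc _ k]
  have hseg₂ : ∀ k ≤ m,
      q (n + 2 * (m + 1) + k) = q (n + 2 * (m + 1)) - (∑ i ∈ range k, g (n + i)) • q 0 := by
    refine eq_sub_sum_zsmul_of_step (fun i => g (n + i)) (fun k => q (n + 2 * (m + 1) + k))
      (q 0) _ fun k hk => ?_
    rw [hstep _ (by omega), coverReturn, coverSucc, if_neg (by omega), if_neg (by omega),
      if_neg (by omega), if_neg (by omega), if_neg (by omega), Nat.add_sub_cancel_left,
      add_assoc _ k]
  constructor
  · have h1 := hseg₁ m le_rfl
    rw [hstep _ (by omega), coverReturn, coverSucc, if_neg (by omega), if_pos (by omega),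
      if_neg (by omega), if_pos (by omega), Nat.add_sub_cancel_left, ← sub_eq_zero] at h1
    rw [sum_range_succ, add_smul, ← h1]
    abel
  · intro i hi
    by_cases h1 : i < n + (m + 1)
    · rw [hseg₀ i (by omega), coverCoeff, if_pos h1, if_neg (by omega), if_neg (by omega),
        sub_smul]
      simp
    by_cases h2 : i < n + 2 * (m + 1)
    · obtain ⟨k, rfl⟩ := Nat.exists_eq_add_of_le (not_lt.1 h1)
      rw [hseg₁ k (by omega), coverCoeff, if_neg h1, if_pos h2, if_pos (by omega),
        if_neg (by omega), Nat.add_sub_cancel_left, neg_smul, one_smul, zero_smul]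
      abel
    · obtain ⟨k, rfl⟩ := Nat.exists_eq_add_of_le (not_lt.1 h2)
      rw [hseg₂ k (by omega), coverCoeff, if_neg h1, if_neg h2, if_neg (by omega),
        if_pos (by omega), Nat.add_sub_cancel_left, neg_smul, one_smul, zero_smul]
      abel

/-- The Bowen–Franks group of the fiber product cover for an arbitrary label sequence `g`. -/
lemma nonempty_bowenFranks_addEquiv (g : ℕ → ℤ) (n p S : ℕ) (hn : 1 ≤ n) (hp : 1 ≤ p)
    (hS : (S : ℤ) = ∑ i ∈ Finset.range p, g (n + i))
    (A : Matrix (Fin (n + 3 * p)) (Fin (n + 3 * p)) ℤ)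
    (hA : ∀ i j : Fin (n + 3 * p), A i j =
      (if (j : ℕ) = 0 then coverReturn g n p i else 0) +
        if (j : ℕ) = coverSucc n p i then 1 else 0) :
    Nonempty (((Fin (n + 3 * p) → ℤ) ⧸
        LinearMap.range (Matrix.vecMulLinear (1 - A))) ≃+ (ZMod S × ℤ × ℤ)) := by
  obtain ⟨z, hz⟩ : ∃ z : Fin (n + 3 * p), (z : ℕ) = 0 := ⟨⟨0, by omega⟩, rfl⟩
  obtain ⟨y₁, hy₁⟩ : ∃ y : Fin (n + 3 * p), (y : ℕ) = n + p := ⟨⟨n + p, by omega⟩, rfl⟩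
  obtain ⟨y₂, hy₂⟩ : ∃ y : Fin (n + 3 * p), (y : ℕ) = n + 2 * p := ⟨⟨n + 2 * p, by omega⟩, rfl⟩
  obtain ⟨σ, hσ⟩ : ∃ σ : Fin (n + 3 * p) → Fin (n + 3 * p),
      ∀ i, (σ i : ℕ) = coverSucc n p i := ⟨fun i => ⟨_, coverSucc_lt hp i.2⟩, fun _ => rfl⟩
  have hA' (i j : Fin (n + 3 * p)) :
      (1 - A) i j = (if j = i then 1 else 0) - (if j = z then coverReturn g n p i else 0) -
        if j = σ i then 1 else 0 := by
    rw [Matrix.sub_apply, hA, Matrix.one_apply, sub_sub]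
    simp only [Fin.ext_iff, hz, hσ, eq_comm (a := (i : ℕ))]
  generalize 1 - A = B at *
  have hsum (i : Fin (n + 3 * p)) (a : Fin (n + 3 * p) → ℤ) :
      ∑ j, B i j * a j = a i - coverReturn g n p i * a z - a (σ i) := by
    simp [hA', sub_mul, Finset.sum_sub_distrib, ite_mul]
  have hrow (i : Fin (n + 3 * p)) : B.row i =
      Pi.single i 1 - coverReturn g n p i • Pi.single z 1 - Pi.single (σ i) 1 := by
    ext j
    simp [Matrix.row, hA', Pi.single_apply]
  obtain ⟨q, hq⟩ : ∃ q : ℕ → (Fin (n + 3 * p) → ℤ) ⧸ LinearMap.range (Matrix.vecMulLinear B),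
      ∀ i : Fin (n + 3 * p),
        (LinearMap.range (Matrix.vecMulLinear B)).mkQ (Pi.single i 1) = q i :=
    ⟨fun k => if h : k < n + 3 * p then
      (LinearMap.range (Matrix.vecMulLinear B)).mkQ (Pi.single ⟨k, h⟩ 1) else 0,
      fun i => by simp⟩
  have hstep (k : ℕ) (hk : k < n + 3 * p) :
      q k = coverReturn g n p k • q 0 + q (coverSucc n p k) := by
    have h0 : B.row ⟨k, hk⟩ ∈ LinearMap.range (Matrix.vecMulLinear B) :=
      ⟨Pi.single ⟨k, hk⟩ 1, by rw [Matrix.vecMulLinear_apply, Matrix.single_one_vecMul]⟩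
    rw [← Submodule.ker_mkQ (LinearMap.range _), LinearMap.mem_ker, hrow, map_sub, map_sub,
      map_smul, hq, hq, hq, sub_sub, sub_eq_zero, hz, hσ] at h0
    exact h0
  obtain ⟨hSq, hcoeff⟩ := cover_relations q g n p hp hstep
  have ha₀ : coverCoeff g n p 0 = 1 := by simp [coverCoeff, show 0 < n by omega]
  refine nonempty_quotient_addEquiv_of_coeffs B S (fun i => coverCoeff g n p i)
    (fun i => if n + p ≤ (i : ℕ) ∧ (i : ℕ) < n + 2 * p then 1 else 0)
    (fun i => if n + 2 * p ≤ (i : ℕ) then 1 else 0) z y₁ y₂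
    (fun i => ?_) (fun i => ?_) (fun i => ?_) ⟨?_, ?_, ?_⟩ ⟨?_, ?_, ?_⟩ ⟨?_, ?_, ?_⟩ ?_
    (fun i => ?_)
  · rw [hsum, hz, hσ, ha₀, mul_one, hS]
    exact dvd_coverCoeff_sub g n p hp i i.2
  · have hi := i.2
    rw [hsum, hz, hσ, if_neg (c := n + p ≤ 0 ∧ _) (by omega), mul_zero, sub_zero, sub_eq_zero]
    refine if_congr ?_ rfl rfl
    unfold coverSucc
    split_ifs <;> omega
  · have hi := i.2
    rw [hsum, hz, hσ, if_neg (c := n + 2 * p ≤ 0) (by omega), mul_zero, sub_zero, sub_eq_zero]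
    refine if_congr ?_ rfl rfl
    unfold coverSucc
    split_ifs <;> omega
  · rw [hz, ha₀]
  · exact if_neg (by omega)
  · exact if_neg (by omega)
  · rw [hy₁, coverCoeff, if_neg (by omega), if_pos (by omega)]
    simp
  · exact if_pos (by omega)
  · exact if_neg (by omega)
  · rw [hy₂, coverCoeff, if_neg (by omega), if_neg (by omega)]
    simp
  · exact if_neg (by omega)
  · exact if_pos (by omega)
  · rw [hq, hz, hS]
    exact hSq
  · rw [hq, hq, hq, hq, hz, hy₁, hy₂]
    exact hcoeff i i.2

/-- Bowen–Franks group of the fiber product cover: with `g(β)` eventually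
periodic but not periodic, minimal `n ≥ 1`, `p ≥ 1`, `S = g_{n+1} + ⋯ + g_{n+p}`, and
`A_P` the adjacency matrix of the fiber product cover (indices `{1,…,n+p} ∪ {1',…,p'} ∪
{1'',…,p''}`), the Bowen–Franks group `ℤ^{n+3p} / ℤ^{n+3p}(I − A_P)` is isomorphic to
`(ℤ/Sℤ) ⊕ ℤ ⊕ ℤ`. -/
theorem statement16 (β : ℝ) (hβ : 1 < β) (n p : ℕ) (hn : 1 ≤ n) (hp : 1 ≤ p)
    (hper : ∀ k, n ≤ k → genSeq β (k + p) = genSeq β k)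
    (hmin : ∀ n' p' : ℕ, 1 ≤ p' →
      (∀ k, n' ≤ k → genSeq β (k + p') = genSeq β k) → n ≤ n' ∧ p ≤ p')
    (S : ℕ) (hS : S = ∑ i ∈ Finset.range p, genSeq β (n + i))
    (A : Matrix (Fin (n + 3 * p)) (Fin (n + 3 * p)) ℤ)
    (hA : ∀ i j : Fin (n + 3 * p), A i j =
      (if (j : ℕ) = 0 then
        (if (i : ℕ) < n + p then (genSeq β (i : ℕ) : ℤ)
         else if (i : ℕ) < n + 2 * p then (genSeq β (n + ((i : ℕ) - (n + p))) : ℤ)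
         else (genSeq β (n + ((i : ℕ) - (n + 2 * p))) : ℤ))
       else 0)
      + (if ((i : ℕ) < n + p - 1 ∧ (j : ℕ) = (i : ℕ) + 1) ∨
            (n + p ≤ (i : ℕ) ∧ (i : ℕ) < n + 2 * p - 1 ∧ (j : ℕ) = (i : ℕ) + 1) ∨
            (n + 2 * p ≤ (i : ℕ) ∧ (i : ℕ) < n + 3 * p - 1 ∧ (j : ℕ) = (i : ℕ) + 1)
         then 1 else 0)
      + (if ((i : ℕ) = n + p - 1 ∧ (j : ℕ) = n) ∨
            ((i : ℕ) = n + 2 * p - 1 ∧ (j : ℕ) = n + p) ∨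
            ((i : ℕ) = n + 3 * p - 1 ∧ (j : ℕ) = n + 2 * p)
         then 1 else 0)) :
    Nonempty (((Fin (n + 3 * p) → ℤ) ⧸
        LinearMap.range (Matrix.vecMulLinear (1 - A))) ≃+ (ZMod S × ℤ × ℤ)) := by
  refine nonempty_bowenFranks_addEquiv (fun i => (genSeq β i : ℤ)) n p S hn hp
    (by rw [hS]; push_cast; rfl) A fun i j => ?_
  rw [hA, add_assoc]
  have hi := i.2
  congr 1
  unfold coverSucc
  split_ifs <;> first | rfl | omega
end

section
/- Let β > 1 with generating sequence g(β), and let φ send a sequence x : ℕ → ℕ to the {0,1}-valued sequence obtained by concatenating the blocks 1^{x_0}0, 1^{x_1}0, 1^{x_2}0, …, where we index g(β) from 0 so that φ(g(β)) = 1^{g_1}0 · 1^{g_2}0 ⋯. Then the image of the right-ray space of X_β under φ equals the right-ray space determined by φ(g(β)): { φ(x) : x ∈ X_β^+ } = { y : ℕ → {0,1} | ∀ k ≥ 0, σ^k(y) ≤lex φ(g(β)) }. -/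
/-- Starting position of the `i`-th block `1^{x_i}0` in the concatenation `φ(x)`. -/
def blockStart (x : ℕ → ℕ) (i : ℕ) : ℕ :=
  ∑ j ∈ Finset.range i, (x j + 1)

/- The block-substitution map `φ`: the sequence obtained by concatenating
`1^{x_0}0 · 1^{x_1}0 · 1^{x_2}0 ⋯`.  Position `m` carries a `0` exactly when it is the
final letter of some block. -/
open scoped Classical in
noncomputable def phi (x : ℕ → ℕ) (m : ℕ) : ℕ :=
  if ∃ i, blockStart x i + x i = m then 0 else 1

theorem lexLt_iff_toLex_lt {x y : ℕ → ℕ} : lexLt x y ↔ toLex x < toLex y := Iff.rfl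

theorem lexLe_iff_toLex_le {x y : ℕ → ℕ} : lexLe x y ↔ toLex x ≤ toLex y := by
  rw [le_iff_eq_or_lt, lexLe, lexLt_iff_toLex_lt, toLex_inj]
  rfl

theorem blockStart_succ (x : ℕ → ℕ) (i : ℕ) :
    blockStart x (i + 1) = blockStart x i + x i + 1 := by
  simp [blockStart, Finset.sum_range_succ, add_assoc]

theorem blockStart_succ' (x : ℕ → ℕ) (i : ℕ) :
    blockStart x (i + 1) = x 0 + 1 + blockStart (fun n => x (1 + n)) i := by
  simp [blockStart, Finset.sum_range_succ', add_comm]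

theorem exists_eq_blockStart_add (x : ℕ → ℕ) (m : ℕ) :
    ∃ i j, j ≤ x i ∧ m = blockStart x i + j := by
  induction m with
  | zero => exact ⟨0, 0, Nat.zero_le _, by simp [blockStart]⟩
  | succ m ih =>
    obtain ⟨i, j, hj, rfl⟩ := ih
    rcases hj.lt_or_eq with h | rfl
    · exact ⟨i, j + 1, h, by omega⟩
    · exact ⟨i + 1, 0, Nat.zero_le _, (blockStart_succ x i).symm⟩

theorem phi_of_lt {x : ℕ → ℕ} {m : ℕ} (h : m < x 0) : phi x m = 1 := by
  rw [phi, if_neg]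
  rintro ⟨_ | i, hi⟩
  · simp only [blockStart, Finset.range_zero, Finset.sum_empty] at hi
    omega
  · rw [blockStart_succ'] at hi
    omega

theorem phi_head (x : ℕ → ℕ) : phi x (x 0) = 0 := by
  rw [phi, if_pos ⟨0, by simp [blockStart]⟩]

theorem phi_head_add (x : ℕ → ℕ) (m : ℕ) :
    phi x (x 0 + 1 + m) = phi (fun n => x (1 + n)) m := by
  have h : (∃ i, blockStart x i + x i = x 0 + 1 + m) ↔
      ∃ i, blockStart (fun n => x (1 + n)) i + x (1 + i) = m := by
    constructor
    · rintro ⟨_ | i, hi⟩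
      · simp only [blockStart, Finset.range_zero, Finset.sum_empty] at hi
        omega
      · refine ⟨i, ?_⟩
        rw [blockStart_succ', add_comm i 1] at hi
        omega
    · rintro ⟨i, hi⟩
      refine ⟨i + 1, ?_⟩
      rw [blockStart_succ', add_comm i 1]
      omega
  classical
  unfold phi
  exact if_congr h rfl rfl

theorem phi_blockStart_add (x : ℕ → ℕ) (i m : ℕ) :
    phi x (blockStart x i + m) = phi (fun n => x (i + n)) m := by
  induction i generalizing x with
  | zero => simp [blockStart]
  | succ i ih =>
    rw [blockStart_succ', add_assoc (x 0 + 1), phi_head_add, ih]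
    congr 1
    funext n
    congr 1
    omega

theorem lexLt_phi {x y : ℕ → ℕ} (h : lexLt x y) : lexLt (phi x) (phi y) := by
  obtain ⟨n, heq, hlt⟩ := h
  induction n generalizing x y with
  | zero =>
    refine ⟨x 0, fun i hi => ?_, ?_⟩
    · rw [phi_of_lt hi, phi_of_lt (hi.trans hlt)]
    · rw [phi_head, phi_of_lt hlt]
      exact Nat.one_pos
  | succ n ih =>
    have h0 : x 0 = y 0 := heq 0 n.succ_pos
    obtain ⟨m, hm, hlt'⟩ := ih (x := fun n => x (1 + n)) (y := fun n => y (1 + n))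
      (fun i hi => heq (1 + i) (by omega)) (by simpa [add_comm] using hlt)
    refine ⟨x 0 + 1 + m, fun i hi => ?_, ?_⟩
    · rcases lt_trichotomy i (x 0) with h | rfl | h
      · rw [phi_of_lt h, phi_of_lt (h0 ▸ h)]
      · rw [phi_head, h0, phi_head]
      · obtain ⟨j, rfl⟩ := Nat.exists_eq_add_of_le (Nat.succ_le_of_lt h)
        have hj := hm j (by omega)
        rwa [← phi_head_add, ← phi_head_add, ← h0] at hj
    · rwa [phi_head_add, h0, phi_head_add]

theorem strictMono_phi : StrictMono fun x : Lex (ℕ → ℕ) => toLex (phi (ofLex x)) :=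
  fun _ _ h => lexLt_phi h

theorem lexLe_phi_iff {x y : ℕ → ℕ} : lexLe (phi x) (phi y) ↔ lexLe x y := by
  rw [lexLe_iff_toLex_le, lexLe_iff_toLex_le]
  exact strictMono_phi.le_iff_le (a := toLex x) (b := toLex y)

theorem lexLe_phi_add {x : ℕ → ℕ} {j : ℕ} (hj : j ≤ x 0) :
    lexLe (fun n => phi x (j + n)) (phi x) := by
  rcases Nat.eq_zero_or_pos j with rfl | hpos
  · left
    simp
  · refine Or.inr ⟨x 0 - j, fun i hi => ?_, ?_⟩
    · simp only
      rw [phi_of_lt (by omega), phi_of_lt (by omega)]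
    · simp only
      rw [Nat.add_sub_cancel' hj, phi_head, phi_of_lt (by omega)]
      exact Nat.one_pos

theorem phi_le_one (x : ℕ → ℕ) (m : ℕ) : phi x m ≤ 1 := by
  unfold phi
  split_ifs <;> simp

theorem exists_eq_phi {z : ℕ → ℕ} (hz : ∀ m, z m ≤ 1) (hzero : ∀ k, ∃ m, z (k + m) = 0) :
    ∃ x, z = phi x := by
  classical
  let p : ℕ → ℕ := fun i => Nat.rec 0 (fun _ s => s + Nat.find (hzero s) + 1) i
  let x : ℕ → ℕ := fun i => Nat.find (hzero (p i))
  have hp : ∀ i, blockStart x i = p i := by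
    intro i
    induction i with
    | zero => simp [blockStart, p]
    | succ i ih => rw [blockStart_succ, ih]
  refine ⟨x, funext fun m => ?_⟩
  obtain ⟨i, j, hj, rfl⟩ := exists_eq_blockStart_add x m
  rw [phi_blockStart_add, hp]
  rcases hj.lt_or_eq with h | rfl
  · rw [phi_of_lt (by simpa using h)]
    have := Nat.find_min (hzero (p i)) h
    have := hz (p i + j)
    omega
  · exact (Nat.find_spec (hzero (p i))).trans (phi_head fun n => x (i + n)).symm

theorem exists_eq_zero_of_lexLe_phi {z g : ℕ → ℕ} (hz : ∀ m, z m ≤ 1) (h : lexLe z (phi g)) :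
    ∃ m, z m = 0 := by
  rcases h with rfl | ⟨n, -, hn⟩
  · exact ⟨g 0, phi_head g⟩
  · exact ⟨n, by have := phi_le_one g n; omega⟩

theorem image_phi_shift_lexLe (g : ℕ → ℕ) :
    { z : ℕ → ℕ | ∃ x : ℕ → ℕ, (∀ k, lexLe (fun n => x (k + n)) g) ∧ z = phi x } =
      { z : ℕ → ℕ | (∀ m, z m ≤ 1) ∧ ∀ k, lexLe (fun i => z (k + i)) (phi g) } := by
  ext z
  constructor
  · rintro ⟨x, hx, rfl⟩
    refine ⟨phi_le_one x, fun k => ?_⟩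
    obtain ⟨i, j, hj, rfl⟩ := exists_eq_blockStart_add x k
    have h₁ := lexLe_phi_add (x := fun n => x (i + n)) hj
    have h₂ := lexLe_phi_iff.2 (hx i)
    simp only [add_assoc, phi_blockStart_add]
    rw [lexLe_iff_toLex_le] at h₁ h₂ ⊢
    exact h₁.trans h₂
  · rintro ⟨hz, hle⟩
    obtain ⟨x, rfl⟩ := exists_eq_phi hz fun k =>
      exists_eq_zero_of_lexLe_phi (fun m => hz (k + m)) (hle k)
    refine ⟨x, fun i => lexLe_phi_iff.1 ?_, rfl⟩
    simpa only [phi_blockStart_add] using hle (blockStart x i)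

/-- the image of the right-ray space of `X_β` under `φ` equals the right-ray
space determined by `φ(g(β))`:
`{ φ(x) : x ∈ X_β⁺ } = { y : ℕ → {0,1} | ∀ k ≥ 0, σ^k(y) ≤lex φ(g(β)) }`. -/
theorem statement18 (β : ℝ) (hβ : 1 < β) :
    { z : ℕ → ℕ | ∃ x : ℕ → ℕ, rightRay β x ∧ z = phi x } =
      { z : ℕ → ℕ | (∀ m : ℕ, z m ≤ 1) ∧
        ∀ k : ℕ, lexLe (fun i : ℕ => z (k + i)) (phi (genSeq β)) } := by
  exact image_phi_shift_lexLe (genSeq β)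
end
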